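/- arXiv:1711.04631 — 2 statements merged into one kernel-verified Lean document; each statement's English description precedes it below -/
import Mathlib

section
/- Let K ⊂ H⁺(y₀)×X be an invariant set, let (N₁,N₂) and (M₁,M₂) be index pairs for (y₀,K), and let N ⊂ H⁺(y₀)×X be a strongly admissible neighborhood of K. Then there exist t₀ ≥ 0 and an index pair (L₁,L₂) for (y₀,K) such that L₁ ⊂ r⁻¹(N) ∩ N₁ ∩ M₁ and L₂ ⊂ N₂^{−t₀}(N₁) ∩ M₂^{−t₀}(M₁). -/
open Filter Topology Set
open scoped NNReal ENNReal

noncomputable section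

/-- A partial semiflow on a topological space `Z`. The value `none` plays the role of the
symbol `◊` ("undefined").  Time is modelled by `ℝ≥0`. -/
structure PartialSemiflow (Z : Type*) [TopologicalSpace Z] where
  /-- The (partially defined) flow map. -/
  flow : ℝ≥0 → Z → Option Z
  /-- The domain of definition is open in `[0,∞) × Z`. -/
  isOpen_dom : IsOpen {p : ℝ≥0 × Z | (flow p.1 p.2).isSome = true}
  /-- The flow is continuous on its domain of definition. -/
  continuous_flow : ∀ V : Set Z, IsOpen V →
    IsOpen {p : ℝ≥0 × Z | ∃ z ∈ V, flow p.1 p.2 = some z}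
  /-- `z π 0 = z`. -/
  flow_zero : ∀ z, flow 0 z = some z
  /-- The semigroup property; `◊ π t = ◊` is built into `Option.bind`. -/
  flow_add : ∀ (t₁ t₂ : ℝ≥0) (z : Z), flow (t₁ + t₂) z = (flow t₁ z).bind (flow t₂)

namespace PartialSemiflow

variable {Z : Type*} [TopologicalSpace Z] (π : PartialSemiflow Z)

/-- `π.mem t z M` means: `z π t` is defined and belongs to `M`. -/
def mem (t : ℝ≥0) (z : Z) (M : Set Z) : Prop := ∃ w ∈ M, π.flow t z = some w

/-- `π.segMem t z M` means `z π [0,t] ⊆ M`. -/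
def segMem (t : ℝ≥0) (z : Z) (M : Set Z) : Prop := ∀ s ≤ t, π.mem s z M

/-- A full solution `u : ℝ → Z` of the semiflow. -/
def IsSolution (u : ℝ → Z) : Prop :=
  ∀ (t₀ : ℝ) (s : ℝ≥0), π.flow s (u t₀) = some (u (t₀ + (s : ℝ)))

/-- The largest invariant subset of `N`. -/
def Inv (N : Set Z) : Set Z :=
  {z | ∃ u : ℝ → Z, π.IsSolution u ∧ (∀ t, u t ∈ N) ∧ u 0 = z}

/-- The largest negatively invariant subset of `N` (solutions on `(-∞,0]`). -/
def InvMinus (N : Set Z) : Set Z :=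
  {z | ∃ u : ℝ → Z, (∀ t ≤ (0 : ℝ), u t ∈ N) ∧
    (∀ (t₀ : ℝ) (s : ℝ≥0), t₀ + (s : ℝ) ≤ 0 → π.flow s (u t₀) = some (u (t₀ + (s : ℝ)))) ∧
    u 0 = z}

/-- Strong admissibility of a set `M`: asymptotic compactness together with
non-explosion of the semiflow in `M`. -/
def StronglyAdmissible (M : Set Z) : Prop :=
  (∀ (z : ℕ → Z) (t : ℕ → ℝ≥0),
      (∀ n, π.segMem (t n) (z n) M) →
      ∃ w : ℕ → Z, (∀ n, π.flow (t n) (z n) = some (w n)) ∧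
        ∃ φ : ℕ → ℕ, StrictMono φ ∧ ∃ l : Z, Tendsto (w ∘ φ) atTop (nhds l)) ∧
  (∀ (z : Z) (t : ℝ≥0), (∀ s < t, ∃ w ∈ M, π.flow s z = some w) → (π.flow t z).isSome)

end PartialSemiflow

/-- A global (everywhere defined) semiflow on `Y`, the "translation" `y ↦ y^t`. -/
structure GlobalSemiflow (Y : Type*) [TopologicalSpace Y] where
  /-- The translation map. -/
  trans : ℝ≥0 → Y → Y
  continuous_trans : Continuous fun p : ℝ≥0 × Y => trans p.1 p.2
  trans_zero : ∀ y, trans 0 y = y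
  trans_add : ∀ (s t : ℝ≥0) (y : Y), trans (s + t) y = trans t (trans s y)

variable {X Y : Type*} [MetricSpace X] [MetricSpace Y]

/-- `π` is a skew-product semiflow over the translation semiflow `σ`:  whenever
`(y,x) π t` is defined, its first component is `y^t`. -/
def GlobalSemiflow.IsSkewProduct (σ : GlobalSemiflow Y) (π : PartialSemiflow (Y × X)) : Prop :=
  ∀ (t : ℝ≥0) (y : Y) (x : X) (w : Y × X), π.flow t (y, x) = some w → w.1 = σ.trans t y

/-- The positive hull `H⁺(y₀)` of `y₀`. -/
def hullPlus (σ : GlobalSemiflow Y) (y₀ : Y) : Set Y :=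
  closure {y | ∃ t : ℝ≥0, σ.trans t y₀ = y}

/-- The space `H⁺(y₀) × X`, as a subset of `Y × X`. -/
def extSpace (σ : GlobalSemiflow Y) (y₀ : Y) : Set (Y × X) :=
  (hullPlus σ y₀) ×ˢ (Set.univ : Set X)

/-- The map `r = r_{y₀} : [0,∞) × X → H⁺(y₀) × X`, `r(t,x) = (y₀^t, x)`. -/
def rMap (σ : GlobalSemiflow Y) (y₀ : Y) : ℝ≥0 × X → Y × X :=
  fun p => (σ.trans p.1 y₀, p.2)

/-- The canonical semiflow `χ = χ_{y₀}` on `[0,∞) × X`: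
`(t,x) χ s = (t+s, Φ(s, y₀^t, x))`. -/
def chi (σ : GlobalSemiflow Y) (π : PartialSemiflow (Y × X)) (y₀ : Y)
    (s : ℝ≥0) (p : ℝ≥0 × X) : Option (ℝ≥0 × X) :=
  (π.flow s (σ.trans p.1 y₀, p.2)).map fun w => (p.1 + s, w.2)

/-- `chiMem σ π y₀ s p M` means: `p χ s` is defined and belongs to `M`. -/
def chiMem (σ : GlobalSemiflow Y) (π : PartialSemiflow (Y × X)) (y₀ : Y)
    (s : ℝ≥0) (p : ℝ≥0 × X) (M : Set (ℝ≥0 × X)) : Prop :=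
  ∃ q ∈ M, chi σ π y₀ s p = some q

/-- `N` is an isolating neighborhood for `K` in `H⁺(y₀) × X`. -/
def IsIsolatingNbhd (σ : GlobalSemiflow Y) (π : PartialSemiflow (Y × X)) (y₀ : Y)
    (K N : Set (Y × X)) : Prop :=
  N ⊆ extSpace σ y₀ ∧ IsClosed N ∧
  (∀ z ∈ π.Inv N, N ∈ nhdsWithin z (extSpace σ y₀)) ∧ K = π.Inv N

/-- `W` is a neighborhood of `K` in `H⁺(y₀) × X`. -/
def IsNbhdOfIn (σ : GlobalSemiflow Y) (y₀ : Y) (K W : Set (Y × X)) : Prop :=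
  W ⊆ extSpace σ y₀ ∧ ∀ z ∈ K, W ∈ nhdsWithin z (extSpace (X := X) σ y₀)

/-- A basic index pair in `[0,∞) × X` relative to the semiflow `χ_{y₀}`. -/
structure IsBasicIndexPair (σ : GlobalSemiflow Y) (π : PartialSemiflow (Y × X)) (y₀ : Y)
    (N₁ N₂ : Set (ℝ≥0 × X)) : Prop where
  subset : N₂ ⊆ N₁
  closed₁ : IsClosed N₁
  closed₂ : IsClosed N₂
  ip2 : ∀ p ∈ N₁, ∀ t : ℝ≥0, ¬ chiMem σ π y₀ t p N₁ → ∃ s ≤ t, chiMem σ π y₀ s p N₂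
  ip3 : ∀ p ∈ N₂, ∀ t : ℝ≥0, ¬ chiMem σ π y₀ t p N₂ → ∃ s ≤ t, ¬ chiMem σ π y₀ s p N₁

/-- An index pair for `(y₀, K)`. -/
structure IsIndexPair (σ : GlobalSemiflow Y) (π : PartialSemiflow (Y × X)) (y₀ : Y)
    (K : Set (Y × X)) (N₁ N₂ : Set (ℝ≥0 × X)) : Prop where
  toBasic : IsBasicIndexPair σ π y₀ N₁ N₂
  ip4 : ∃ N : Set (Y × X), IsIsolatingNbhd σ π y₀ K N ∧ π.StronglyAdmissible N ∧
    N₁ \ N₂ ⊆ rMap σ y₀ ⁻¹' N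
  ip5 : ∃ W : Set (Y × X), IsNbhdOfIn σ y₀ K W ∧ rMap σ y₀ ⁻¹' W ⊆ N₁ \ N₂

/-- `N₂^{-T}(N₁) = {p ∈ N₁ : p χ s ∈ N₂ for some s ∈ [0,T]}`. -/
def backSet (σ : GlobalSemiflow Y) (π : PartialSemiflow (Y × X)) (y₀ : Y)
    (N₁ N₂ : Set (ℝ≥0 × X)) (T : ℝ≥0) : Set (ℝ≥0 × X) :=
  {p ∈ N₁ | ∃ s ≤ T, chiMem σ π y₀ s p N₂}


/-- The relation identifying all points of `A ∩ B`, together with an extra point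
(which serves as the class `[B]` even when `A ∩ B = ∅`). -/
def quotRel {Z : Type*} (A B : Set Z) : ↥A ⊕ Unit → ↥A ⊕ Unit → Prop
  | Sum.inl a, Sum.inl b => a = b ∨ ((a : Z) ∈ B ∧ (b : Z) ∈ B)
  | Sum.inl a, Sum.inr _ => (a : Z) ∈ B
  | Sum.inr _, Sum.inl b => (b : Z) ∈ B
  | Sum.inr _, Sum.inr _ => True

/-- The pointed quotient space `A/B`. -/
def PtdQuot {Z : Type*} [TopologicalSpace Z] (A B : Set Z) : Type _ := Quot (quotRel A B)

instance {Z : Type*} [TopologicalSpace Z] (A B : Set Z) : TopologicalSpace (PtdQuot A B) :=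
  inferInstanceAs (TopologicalSpace (Quot _))

/-- The base point `[B]` of `A/B`. -/
def PtdQuot.pt {Z : Type*} [TopologicalSpace Z] (A B : Set Z) : PtdQuot A B :=
  Quot.mk _ (Sum.inr ())

/-- `f : (Z, z₀) → (W, w₀)` is a pointed homotopy equivalence. -/
def IsPointedHomotopyEquiv {Z W : Type*} [TopologicalSpace Z] [TopologicalSpace W]
    (z₀ : Z) (w₀ : W) (f : C(Z, W)) : Prop :=
  f z₀ = w₀ ∧ ∃ g : C(W, Z), g w₀ = z₀ ∧
    Nonempty (ContinuousMap.HomotopyRel (g.comp f) (ContinuousMap.id Z) {z₀}) ∧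
    Nonempty (ContinuousMap.HomotopyRel (f.comp g) (ContinuousMap.id W) {w₀})

/-- There is a pointed homotopy equivalence `(Z,z₀) → (W,w₀)`. -/
def PointedHomotopyEquivalent {Z W : Type*} [TopologicalSpace Z] [TopologicalSpace W]
    (z₀ : Z) (w₀ : W) : Prop :=
  ∃ f : C(Z, W), IsPointedHomotopyEquiv z₀ w₀ f

variable {X Y : Type*} [MetricSpace X] [MetricSpace Y]

/-- `g⁺(z) = sup{t ≥ 0 : z π [0,t] ⊆ U}`, with `sup ∅ = 0`, valued in `[0,∞]`. -/
def gPlus (π : PartialSemiflow (Y × X)) (U : Set (Y × X)) (z : Y × X) : ℝ≥0∞ :=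
  ⨆ t ∈ {t : ℝ≥0 | π.segMem t z U}, (t : ℝ≥0∞)

/-- `g⁻(z) = sup{d(z π t, Inv⁻(N)) : t ∈ [0, g⁺(z)], z π t ≠ ◊}`, with `sup ∅ = 0`
and `d(·,∅) = ∞`, valued in `[0,∞]`. -/
def gMinus (π : PartialSemiflow (Y × X)) (U N : Set (Y × X)) (z : Y × X) : ℝ≥0∞ :=
  ⨆ t ∈ {t : ℝ≥0 | (t : ℝ≥0∞) ≤ gPlus π U z},
    ⨆ w ∈ {w : Y × X | π.flow t z = some w}, EMetric.infEdist w (π.InvMinus N)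

/-- The function `f(p) = sup{t₀ ≥ 0 : p χ s ∈ cl(N₁ \ N₂) for all s ∈ [0,t₀]}`,
with `sup ∅ = 0`, valued in `[0,∞]`. -/
def fTime (σ : GlobalSemiflow Y) (π : PartialSemiflow (Y × X)) (y₀ : Y)
    (N₁ N₂ : Set (ℝ≥0 × X)) (p : ℝ≥0 × X) : ℝ≥0∞ :=
  ⨆ t₀ ∈ {t₀ : ℝ≥0 | ∀ s ≤ t₀, chiMem σ π y₀ s p (closure (N₁ \ N₂))}, (t₀ : ℝ≥0∞)

/-- The α-limit set of a full solution `u`. -/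
def solAlphaLimit (u : ℝ → Y × X) : Set (Y × X) := ⋂ t : ℝ, closure (u '' Set.Iic t)

/-- The ω-limit set of a full solution `u`. -/
def solOmegaLimit (u : ℝ → Y × X) : Set (Y × X) := ⋂ t : ℝ, closure (u '' Set.Ici t)

/-- `(A, R)` is an attractor-repeller decomposition of the isolated invariant set `K`. -/
structure IsARDecomp (σ : GlobalSemiflow Y) (π : PartialSemiflow (Y × X)) (y₀ : Y)
    (K A R : Set (Y × X)) : Prop where
  A_subset : A ⊆ K
  R_subset : R ⊆ K
  disjoint : Disjoint A R
  A_isolated : ∃ N, IsIsolatingNbhd σ π y₀ A N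
  R_isolated : ∃ N, IsIsolatingNbhd σ π y₀ R N
  alternatives : ∀ u : ℝ → Y × X, π.IsSolution u → (∀ t, u t ∈ K) →
    (∀ t, u t ∈ A) ∨ (∀ t, u t ∈ R) ∨ (solAlphaLimit u ⊆ R ∧ solOmegaLimit u ⊆ A)

/-- An index triple for `(y₀, K, A, R)`. -/
structure IsIndexTriple (σ : GlobalSemiflow Y) (π : PartialSemiflow (Y × X)) (y₀ : Y)
    (K A R : Set (Y × X)) (N₁ N₂ N₃ : Set (ℝ≥0 × X)) : Prop where
  sub32 : N₃ ⊆ N₂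
  sub21 : N₂ ⊆ N₁
  pairK : IsIndexPair σ π y₀ K N₁ N₃
  pairA : IsIndexPair σ π y₀ A N₂ N₃

/-- An FM-index pair for `K` relative to `π`, restricted to `H⁺(y₀) × X`. -/
structure IsFMIndexPair (σ : GlobalSemiflow Y) (π : PartialSemiflow (Y × X)) (y₀ : Y)
    (K N₁ N₂ : Set (Y × X)) : Prop where
  subset : N₂ ⊆ N₁
  sub_ext : N₁ ⊆ extSpace σ y₀
  closed₁ : IsClosed N₁
  closed₂ : IsClosed N₂
  isolating : IsIsolatingNbhd σ π y₀ K (closure (N₁ \ N₂))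
  interior_K : ∀ z ∈ K, N₁ \ N₂ ∈ nhdsWithin z (extSpace σ y₀)
  posInv : ∀ z ∈ N₂, ∀ t : ℝ≥0, (∀ s ≤ t, π.mem s z N₁) → ∀ s ≤ t, π.mem s z N₂
  exit : ∀ z ∈ N₁, ∀ t : ℝ≥0, ¬ π.mem t z N₁ →
    ∃ s ≤ t, (∀ s' ≤ s, π.mem s' z N₁) ∧ π.mem s z N₂


namespace PartialSemiflow

variable {Z : Type*} [MetricSpace Z] {π : PartialSemiflow Z}

theorem mem.mono {t : ℝ≥0} {z : Z} {A B : Set Z} (h : π.mem t z A) (hAB : A ⊆ B) :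
    π.mem t z B := by
  obtain ⟨w, hw, e⟩ := h
  exact ⟨w, hAB hw, e⟩

theorem segMem.mono {t : ℝ≥0} {z : Z} {A B : Set Z} (h : π.segMem t z A) (hAB : A ⊆ B) :
    π.segMem t z B := fun s hs => (h s hs).mono hAB

theorem mem_zero_iff {z : Z} {A : Set Z} : π.mem 0 z A ↔ z ∈ A := by
  simp [mem, π.flow_zero]

theorem mem_add_iff {s t : ℝ≥0} {z w : Z} {A : Set Z} (h : π.flow s z = some w) :
    π.mem (s + t) z A ↔ π.mem t w A := by
  simp [mem, π.flow_add, h]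

theorem segMem.add {s t : ℝ≥0} {z w : Z} {A : Set Z} (h : π.segMem s z A)
    (hw : π.flow s z = some w) (h' : π.segMem t w A) : π.segMem (s + t) z A := by
  intro r hr
  rcases le_total r s with hrs | hrs
  · exact h r hrs
  · obtain ⟨c, rfl⟩ := exists_add_of_le hrs
    exact (mem_add_iff hw).2 (h' c (by simpa using hr))

theorem segMem.of_add {s t : ℝ≥0} {z w : Z} {A : Set Z} (h : π.segMem (s + t) z A)
    (hw : π.flow s z = some w) : π.segMem t w A := fun r hr =>
  (mem_add_iff hw).1 (h (s + r) (by gcongr))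

theorem isSome_of_le {s t : ℝ≥0} {z : Z} (hst : s ≤ t) (h : (π.flow t z).isSome) :
    (π.flow s z).isSome := by
  obtain ⟨c, rfl⟩ := exists_add_of_le hst
  rw [π.flow_add] at h
  cases h' : π.flow s z <;> simp_all

theorem isOpen_mem (t : ℝ≥0) {O : Set Z} (hO : IsOpen O) : IsOpen {z | π.mem t z O} :=
  (π.continuous_flow O hO).preimage (f := fun z : Z => (t, z)) (by fun_prop)

theorem isOpen_mem_time (z : Z) {O : Set Z} (hO : IsOpen O) :
    IsOpen {t : ℝ≥0 | π.mem t z O} :=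
  (π.continuous_flow O hO).preimage (f := fun t : ℝ≥0 => (t, z)) (by fun_prop)

theorem isOpen_segMem (t : ℝ≥0) {O : Set Z} (hO : IsOpen O) : IsOpen {z | π.segMem t z O} := by
  rw [isOpen_iff_mem_nhds]
  intro z hz
  have := (isCompact_Icc (a := (0 : ℝ≥0)) (b := t)).eventually_forall_of_forall_eventually
    (x₀ := z) (P := fun z s => π.mem s z O) (by
      intro s hs
      have h1 : {p : ℝ≥0 × Z | π.mem p.1 p.2 O} ∈ 𝓝 (s, z) :=
        (π.continuous_flow O hO).mem_nhds (hz s hs.2)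
      exact (continuous_swap.tendsto (z, s)).eventually h1)
  filter_upwards [this] with y hy s hs
  exact hy s ⟨zero_le, hs⟩

/-- A closed set containing an orbit on `[0, s)` contains its value at `s > 0`. -/
theorem mem_of_forall_lt {s : ℝ≥0} {z w : Z} {C : Set Z} (hC : IsClosed C) (hs : 0 < s)
    (h : ∀ r < s, π.mem r z C) (hw : π.flow s z = some w) : w ∈ C := by
  by_contra hwC
  have h1 : {t : ℝ≥0 | π.mem t z Cᶜ} ∈ 𝓝 s :=
    (isOpen_mem_time z hC.isOpen_compl).mem_nhds ⟨w, hwC, hw⟩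
  obtain ⟨a, ha, hsub⟩ := exists_Ioc_subset_of_mem_nhds h1 ⟨0, hs⟩
  obtain ⟨b, hab, hbs⟩ := exists_between ha
  obtain ⟨v, hv, e⟩ := hsub ⟨hab, hbs.le⟩
  obtain ⟨v', hv', e'⟩ := h b hbs
  rw [e] at e'
  exact hv (by simpa using (Option.some.inj e') ▸ hv')

theorem StronglyAdmissible.mono {A B : Set Z} (h : π.StronglyAdmissible B) (hAB : A ⊆ B) :
    π.StronglyAdmissible A :=
  ⟨fun z t hz => h.1 z t fun n => (hz n).mono hAB,
    fun z t hz => h.2 z t fun s hs => mem.mono (π := π) (hz s hs) hAB⟩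

/-- Orbit segments in a closed strongly admissible set are stable under limits. -/
theorem StronglyAdmissible.segMem_of_tendsto {M : Set Z} (hM : π.StronglyAdmissible M)
    (hc : IsClosed M) {z : ℕ → Z} {l : Z} (hz : Tendsto z atTop (𝓝 l)) {t : ℝ≥0}
    (h : ∀ᶠ n in atTop, π.segMem t (z n) M) : π.segMem t l M := by
  have key : ∀ s ≤ t, (π.flow s l).isSome → π.mem s l M := by
    intro s hs hd
    obtain ⟨w, hw⟩ := Option.isSome_iff_exists.1 hd
    refine ⟨w, ?_, hw⟩
    by_contra hwM
    have h1 := hz.eventually ((isOpen_mem (π := π) s hc.isOpen_compl).mem_nhds ⟨w, hwM, hw⟩)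
    obtain ⟨n, ⟨v, hv, e⟩, hn⟩ := (h1.and h).exists
    obtain ⟨v', hv', e'⟩ := hn s hs
    rw [e] at e'
    exact hv ((Option.some.inj e') ▸ hv')
  refine fun s hs => key s hs ?_
  by_contra hnone
  have hcl : IsClosed {r : ℝ≥0 | ¬ (π.flow r l).isSome} := by
    have : IsOpen {r : ℝ≥0 | (π.flow r l).isSome} :=
      π.isOpen_dom.preimage (f := fun r : ℝ≥0 => (r, l)) (by fun_prop)
    exact this.isClosed_compl
  have hmem := hcl.csInf_mem ⟨s, hnone⟩ (OrderBot.bddBelow _)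
  refine hmem (hM.2 l _ fun r hr => ?_)
  have hr' : (π.flow r l).isSome := by
    by_contra hr'
    exact absurd (csInf_le (OrderBot.bddBelow _) hr') (not_le.2 hr)
  exact key r (hr.le.trans ((csInf_le (OrderBot.bddBelow _) hnone).trans hs)) hr'

theorem flow_eq_of_tendsto {z v : ℕ → Z} {l w x : Z} {t : ℝ≥0} (hz : Tendsto z atTop (𝓝 l))
    (h : ∀ n, π.flow t (z n) = some (v n)) (hv : Tendsto v atTop (𝓝 w))
    (hx : π.flow t l = some x) : x = w := by
  refine tendsto_nhds_unique (tendsto_nhds.2 fun V hV hxV => ?_) hv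
  filter_upwards [hz.eventually ((isOpen_mem (π := π) t hV).mem_nhds ⟨x, hxV, hx⟩)] with n hn
  obtain ⟨y, hy, e⟩ := hn
  rw [h n] at e
  rw [mem_preimage, Option.some.inj e]
  exact hy

variable (π) in
/-- End points of orbit segments of length `t` in `M`. -/
def reach (M : Set Z) (t : ℝ≥0) : Set Z := {w | ∃ z, π.segMem t z M ∧ π.flow t z = some w}

theorem reach_anti (M : Set Z) {s t : ℝ≥0} (hst : s ≤ t) : π.reach M t ⊆ π.reach M s := by
  rintro w ⟨z, hz, e⟩
  obtain ⟨c, rfl⟩ := exists_add_of_le hst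
  rw [add_comm] at e hz
  obtain ⟨y, -, hy⟩ := hz c le_self_add
  refine ⟨y, hz.of_add hy, ?_⟩
  simpa [π.flow_add, hy] using e

variable (π) in
/-- Limits of end points of arbitrarily long orbit segments in `M`. -/
def reachLimit (M : Set Z) : Set Z := ⋂ n : ℕ, closure (π.reach M n)

theorem reachLimit_mono {A B : Set Z} (h : A ⊆ B) : π.reachLimit A ⊆ π.reachLimit B :=
  iInter_mono fun _ => closure_mono fun _ ⟨z, hz, e⟩ => ⟨z, hz.mono h, e⟩

theorem isClosed_reachLimit (M : Set Z) : IsClosed (π.reachLimit M) :=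
  isClosed_iInter fun _ => isClosed_closure

theorem StronglyAdmissible.exists_tendsto {M : Set Z} (hM : π.StronglyAdmissible M)
    {v : ℕ → Z} (hv : ∀ n : ℕ, v n ∈ π.reach M n) :
    ∃ φ : ℕ → ℕ, StrictMono φ ∧ ∃ l ∈ π.reachLimit M, Tendsto (v ∘ φ) atTop (𝓝 l) := by
  choose z hz e using hv
  obtain ⟨w, hw, φ, hφ, l, hl⟩ := hM.1 z (fun n => n) hz
  obtain rfl : w = v := funext fun n => Option.some.inj ((hw n).symm.trans (e n))
  refine ⟨φ, hφ, l, mem_iInter.2 fun m => mem_closure_of_tendsto hl ?_, hl⟩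
  filter_upwards [eventually_ge_atTop m] with n hn
  exact reach_anti M (by exact_mod_cast hn.trans (hφ.id_le n)) ⟨_, hz _, e _⟩

theorem exists_seq_tendsto {M : Set Z} {w : ℕ → Z} (hw : ∀ n, w n ∈ π.reachLimit M) (f : ℕ → ℕ) :
    ∃ v : ℕ → Z, (∀ n, v n ∈ π.reach M (f n)) ∧
      Tendsto (fun n => dist (v n) (w n)) atTop (𝓝 0) := by
  have : ∀ n, ∃ v ∈ π.reach M (f n), dist (w n) v < 1 / ((n : ℝ) + 1) := fun n =>
    Metric.mem_closure_iff.1 (mem_iInter.1 (hw n) (f n)) _ Nat.one_div_pos_of_nat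
  choose v hv hd using this
  refine ⟨v, hv, squeeze_zero (fun _ => dist_nonneg) (fun n => ?_)
    tendsto_one_div_add_atTop_nhds_zero_nat⟩
  rw [dist_comm]
  exact (hd n).le

theorem StronglyAdmissible.isCompact_reachLimit {M : Set Z} (hM : π.StronglyAdmissible M) :
    IsCompact (π.reachLimit M) := by
  rw [isCompact_iff_isSeqCompact]
  intro w hw
  obtain ⟨v, hv, hd⟩ := exists_seq_tendsto hw id
  obtain ⟨φ, hφ, l, hl, hlim⟩ := hM.exists_tendsto hv
  exact ⟨l, hl, φ, hφ, hlim.congr_dist (hd.comp hφ.tendsto_atTop)⟩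

theorem StronglyAdmissible.exists_backward {M : Set Z} (hM : π.StronglyAdmissible M)
    (hc : IsClosed M) {w : Z} (hw : w ∈ π.reachLimit M) :
    ∃ w' ∈ π.reachLimit M, π.segMem 1 w' M ∧ π.flow 1 w' = some w := by
  obtain ⟨v, hv, hd⟩ := exists_seq_tendsto (fun _ => hw) (fun n => n + 1)
  have hvw : Tendsto v atTop (𝓝 w) := tendsto_iff_dist_tendsto_zero.2 hd
  choose z hz e using hv
  simp only [Nat.cast_add, Nat.cast_one] at hz e
  have h1 : ∀ n : ℕ, ∃ y, π.flow n (z n) = some y := fun n =>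
    let ⟨y, _, hy⟩ := hz n n le_self_add
    ⟨y, hy⟩
  choose v' hv' using h1
  obtain ⟨φ, hφ, l, hl, hlim⟩ := hM.exists_tendsto (v := v')
    fun n => ⟨z n, fun s hs => hz n s (hs.trans le_self_add), hv' n⟩
  have hs : ∀ n, π.segMem 1 (v' n) M := fun n => (hz n).of_add (hv' n)
  have hf : ∀ n, π.flow 1 (v' n) = some (v n) := fun n => by
    simpa [π.flow_add, hv' n] using e n
  have hseg := hM.segMem_of_tendsto hc hlim (Eventually.of_forall fun n => hs (φ n))
  obtain ⟨x, -, hx⟩ := hseg 1 le_rfl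
  refine ⟨l, hl, hseg, ?_⟩
  rw [hx, flow_eq_of_tendsto hlim (fun n => hf (φ n)) (hvw.comp hφ.tendsto_atTop) hx]

theorem StronglyAdmissible.mem_Inv {M : Set Z} (hM : π.StronglyAdmissible M)
    (hc : IsClosed M) {z : Z} (hz : z ∈ π.reachLimit M) (hfwd : ∀ t, π.mem t z M) :
    z ∈ π.Inv M := by
  choose! b hbS hbM hbf using fun w hw => hM.exists_backward hc (w := w) hw
  set a : ℕ → Z := fun n => b^[n] z with ha
  have haS : ∀ n, a n ∈ π.reachLimit M := by
    intro n
    induction n with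
    | zero => exact hz
    | succ n ih => simpa only [ha, Function.iterate_succ_apply'] using hbS _ ih
  have ha1 : ∀ n, π.flow 1 (a (n + 1)) = some (a n) := fun n => by
    simpa only [ha, Function.iterate_succ_apply'] using hbf _ (haS n)
  have haM : ∀ n, π.segMem 1 (a (n + 1)) M := fun n => by
    simpa only [ha, Function.iterate_succ_apply'] using hbM _ (haS n)
  have hfw : ∀ n t, π.mem t (a n) M := by
    intro n
    induction n with
    | zero => exact hfwd
    | succ n ih => exact fun t => (haM n).add (ha1 n) (fun s _ => ih s) t le_add_self
  have hshift : ∀ (j k : ℕ) (s : ℝ≥0), π.flow (s + j) (a (k + j)) = π.flow s (a k) := by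
    intro j k
    induction j with
    | zero => simp
    | succ j ih =>
      intro s
      rw [← ih s, Nat.cast_succ, ← add_assoc, add_comm _ (1 : ℝ≥0), π.flow_add, ← add_assoc k, ha1]
      rfl
  choose f hfM hf using hfw
  set u : ℝ → Z := fun t => f ⌈|t|⌉₊ (t + ⌈|t|⌉₊).toNNReal with hu
  have hu1 : ∀ (t : ℝ) (k : ℕ), |t| ≤ k → π.flow (t + k).toNNReal (a k) = some (u t) := by
    intro t k hk
    obtain ⟨j, rfl⟩ := exists_add_of_le (Nat.ceil_le.2 hk)
    have h0 : 0 ≤ t + ⌈|t|⌉₊ := by linarith [neg_abs_le t, Nat.le_ceil |t|]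
    rw [Nat.cast_add, ← add_assoc, Real.toNNReal_add h0 (Nat.cast_nonneg j),
      Real.toNNReal_natCast, hshift, hf]
  refine ⟨u, fun t s => ?_, fun t => hfM _ _, ?_⟩
  · obtain ⟨k, hk⟩ := exists_nat_ge (|t| + |t + s|)
    have h1 := hu1 t k (by linarith [abs_nonneg (t + s)])
    have h2 := hu1 (t + s) k (by linarith [abs_nonneg t])
    have h0 : 0 ≤ t + k := by linarith [neg_abs_le t, abs_nonneg (t + s)]
    rw [add_right_comm, Real.toNNReal_add h0 s.coe_nonneg, Real.toNNReal_coe, π.flow_add, h1] at h2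
    simpa using h2
  · have := hu1 0 0 (by simp)
    simpa [ha, π.flow_zero] using this.symm

theorem Inv_subset (M : Set Z) : π.Inv M ⊆ M := by
  rintro z ⟨u, -, h, rfl⟩
  exact h 0

theorem Inv_mono {A B : Set Z} (h : A ⊆ B) : π.Inv A ⊆ π.Inv B :=
  fun _ ⟨u, hu, hA, e⟩ => ⟨u, hu, fun t => h (hA t), e⟩

theorem mem_Inv_of_mem_Inv {M : Set Z} {z : Z} (hz : z ∈ π.Inv M) (t : ℝ≥0) :
    π.mem t z (π.Inv M) := by
  obtain ⟨u, hu, hM, rfl⟩ := hz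
  refine ⟨u t, ⟨fun s => u (t + s), fun r s => ?_, fun s => hM _, by simp⟩, by simpa using hu 0 t⟩
  simpa [add_assoc] using hu (t + r) s

theorem Inv_subset_reachLimit (M : Set Z) : π.Inv M ⊆ π.reachLimit M := by
  rintro z ⟨u, hu, hM, rfl⟩
  refine mem_iInter.2 fun n => subset_closure ⟨u (-n), fun s _ => ⟨_, hM _, hu _ s⟩, ?_⟩
  simpa using hu (-n) n

theorem StronglyAdmissible.isCompact_Inv {M : Set Z} (hM : π.StronglyAdmissible M)
    (hc : IsClosed M) : IsCompact (π.Inv M) := by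
  refine hM.isCompact_reachLimit.of_isClosed_subset ?_ (Inv_subset_reachLimit M)
  refine IsSeqClosed.isClosed fun w l hw hl => ?_
  refine hM.mem_Inv hc ((isClosed_reachLimit M).mem_of_tendsto hl
    (Eventually.of_forall fun n => Inv_subset_reachLimit M (hw n))) fun t => ?_
  exact hM.segMem_of_tendsto hc hl (t := t) (Eventually.of_forall fun n s _ =>
    (mem_Inv_of_mem_Inv (hw n) s).mono (Inv_subset M)) t le_rfl

/-- Points of a closed set disjoint from the invariant set which are close to a compact part of
the unstable set leave the isolating neighborhood in uniformly bounded time. -/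
theorem StronglyAdmissible.exists_exit {M F I : Set Z} (hM : π.StronglyAdmissible M)
    (hc : IsClosed M) (hF : IsClosed F) (hFI : Disjoint F (π.Inv M)) (hI : IsCompact I)
    (hIM : I ⊆ π.reachLimit M) :
    ∃ ε : ℝ, 0 < ε ∧ ∃ T : ℝ≥0, ∀ z ∈ F, z ∈ Metric.cthickening ε I → ¬ π.segMem T z M := by
  by_contra! H
  choose z hzF hzI hzM using fun n : ℕ =>
    H (1 / ((n : ℝ) + 1)) Nat.one_div_pos_of_nat (n : ℝ≥0)
  have : ∀ n : ℕ, ∃ i ∈ I, dist (z n) i ≤ 1 / ((n : ℝ) + 1) := fun n => by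
    have h := hzI n
    rw [hI.cthickening_eq_biUnion_closedBall Nat.one_div_pos_of_nat.le] at h
    simpa using h
  choose i hi hd using this
  obtain ⟨l, hl, φ, hφ, hlim⟩ := hI.isSeqCompact hi
  have hd0 : Tendsto (fun n => dist (i n) (z n)) atTop (𝓝 0) :=
    squeeze_zero (fun _ => dist_nonneg) (fun n => by rw [dist_comm]; exact hd n)
      tendsto_one_div_add_atTop_nhds_zero_nat
  have hz : Tendsto (z ∘ φ) atTop (𝓝 l) := hlim.congr_dist (hd0.comp hφ.tendsto_atTop)
  refine hFI.le_bot ⟨hF.mem_of_tendsto hz (Eventually.of_forall fun n => hzF (φ n)),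
    hM.mem_Inv hc (hIM hl) fun t => hM.segMem_of_tendsto hc hz (t := t) ?_ t le_rfl⟩
  obtain ⟨m, hm⟩ := exists_nat_ge t
  filter_upwards [eventually_ge_atTop m] with n hn s hs
  exact hzM (φ n) s (hs.trans (hm.trans (by exact_mod_cast hn.trans (hφ.id_le n))))

/-- Orbits in a strongly admissible set which start with a sufficiently long segment near
`reachLimit` stay near it. -/
theorem StronglyAdmissible.exists_stay {M : Set Z} (hM : π.StronglyAdmissible M)
    {ε : ℝ} (hε : 0 < ε) :
    ∃ T : ℝ≥0, ∀ z, π.segMem T z (Metric.thickening ε (π.reachLimit M)) →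
      ∀ t, π.segMem t z M → π.mem t z (Metric.cthickening ε (π.reachLimit M)) := by
  by_contra! H
  choose z hz t ht hn using fun n : ℕ => H (n : ℝ≥0)
  have hlt : ∀ n : ℕ, (n : ℝ≥0) ≤ t n := fun n => by
    by_contra! h
    exact hn n ((hz n (t n) h.le).mono (Metric.thickening_subset_cthickening _ _))
  choose w hwM hw using fun n => ht n (t n) le_rfl
  obtain ⟨φ, hφ, l, hl, hlim⟩ := hM.exists_tendsto (v := w)
    fun n => reach_anti M (hlt n) ⟨z n, ht n, hw n⟩
  obtain ⟨n, h⟩ := (hlim.eventually (Metric.isOpen_thickening.mem_nhds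
    (Metric.self_subset_thickening hε _ hl))).exists
  exact hn _ ⟨_, Metric.thickening_subset_cthickening _ _ h, hw _⟩

end PartialSemiflow

section Pairs

variable {σ : GlobalSemiflow Y} {π : PartialSemiflow (Y × X)} {y₀ : Y}

theorem continuous_rMap : Continuous (rMap (X := X) σ y₀) :=
  (σ.continuous_trans.comp (by fun_prop : Continuous fun p : ℝ≥0 × X => (p.1, y₀))).prodMk
    continuous_snd

theorem rMap_mem_extSpace {X : Type*} (p : ℝ≥0 × X) : rMap σ y₀ p ∈ extSpace σ y₀ :=
  ⟨subset_closure ⟨p.1, rfl⟩, trivial⟩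

theorem isClosed_extSpace : IsClosed (extSpace (X := X) σ y₀) :=
  isClosed_closure.prod isClosed_univ

theorem flow_mem_extSpace (hσπ : σ.IsSkewProduct π) {t : ℝ≥0} {z w : Y × X}
    (hz : z ∈ extSpace σ y₀) (h : π.flow t z = some w) : w ∈ extSpace σ y₀ := by
  refine ⟨?_, trivial⟩
  rw [hσπ t z.1 z.2 w h]
  refine map_mem_closure (f := σ.trans t) (σ.continuous_trans.comp (by fun_prop :
    Continuous fun y : Y => (t, y))) hz.1 ?_
  rintro _ ⟨s, rfl⟩
  exact ⟨s + t, σ.trans_add s t y₀⟩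

theorem chiMem_preimage_iff (hσπ : σ.IsSkewProduct π) {s : ℝ≥0} {p : ℝ≥0 × X}
    {P : Set (Y × X)} : chiMem σ π y₀ s p (rMap σ y₀ ⁻¹' P) ↔ π.mem s (rMap σ y₀ p) P := by
  have key : ∀ w, π.flow s (rMap σ y₀ p) = some w → rMap σ y₀ (p.1 + s, w.2) = w := by
    intro w hw
    refine Prod.ext ?_ rfl
    rw [hσπ s _ _ w hw]
    exact σ.trans_add _ _ _
  constructor
  · rintro ⟨q, hq, e⟩
    obtain ⟨w, hw, rfl⟩ := Option.map_eq_some_iff.1 e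
    exact ⟨w, by simpa [key w hw] using hq, hw⟩
  · rintro ⟨w, hw, e⟩
    refine ⟨(p.1 + s, w.2), by simpa [key w e] using hw, ?_⟩
    exact Option.map_eq_some_iff.2 ⟨w, e, rfl⟩

/-- Points of `N₁` that leave a set containing the image of `N₁ \ N₂` within time `T` lie in
`N₂^{-T}(N₁)`. -/
theorem IsBasicIndexPair.mem_backSet (hσπ : σ.IsSkewProduct π) {N₁ N₂ : Set (ℝ≥0 × X)}
    (h : IsBasicIndexPair σ π y₀ N₁ N₂) {N : Set (Y × X)} (hN : N₁ \ N₂ ⊆ rMap σ y₀ ⁻¹' N)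
    {p : ℝ≥0 × X} (hp : p ∈ N₁) {T : ℝ≥0} (hT : ¬ π.segMem T (rMap σ y₀ p) N) :
    p ∈ backSet σ π y₀ N₁ N₂ T := by
  refine ⟨hp, ?_⟩
  by_contra! H
  refine hT fun s hs => (chiMem_preimage_iff hσπ).1 ?_
  by_cases h1 : chiMem σ π y₀ s p N₁
  · obtain ⟨q, hq, e⟩ := h1
    exact ⟨q, hN ⟨hq, fun hq2 => H s hs ⟨q, hq2, e⟩⟩, e⟩
  · obtain ⟨r, hr, h2⟩ := h.ip2 p hp s h1
    exact absurd h2 (H r (hr.trans hs))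

theorem isBasicIndexPair_preimage (hσπ : σ.IsSkewProduct π) {P₁ P₂ : Set (Y × X)}
    (hsub : P₂ ⊆ P₁) (h₁ : IsClosed P₁) (h₂ : IsClosed P₂)
    (hexit : ∀ z ∈ P₁, z ∈ extSpace σ y₀ → ∀ t, ¬ π.mem t z P₁ → ∃ s ≤ t, π.mem s z P₂)
    (hinv : ∀ z ∈ P₂, ∀ t, ¬ π.mem t z P₂ → ∃ s ≤ t, ¬ π.mem s z P₁) :
    IsBasicIndexPair σ π y₀ (rMap σ y₀ ⁻¹' P₁) (rMap σ y₀ ⁻¹' P₂) where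
  subset := preimage_mono hsub
  closed₁ := h₁.preimage continuous_rMap
  closed₂ := h₂.preimage continuous_rMap
  ip2 p hp t := by
    simpa only [chiMem_preimage_iff hσπ] using hexit _ hp (rMap_mem_extSpace p) t
  ip3 p hp t := by
    simpa only [chiMem_preimage_iff hσπ] using hinv _ hp t

end Pairs

namespace PartialSemiflow

variable {Z : Type*} [MetricSpace Z] {π : PartialSemiflow Z}

variable (π) in
/-- Points of `C` whose orbits remain in `C` as long as they stay in `V`. -/
def tube (V C : Set Z) : Set Z := {z ∈ C | ∀ t, π.segMem t z V → π.mem t z C}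

theorem isClosed_tube {V C : Set Z} (hV : IsOpen V) (hC : IsClosed C) :
    IsClosed (π.tube V C) := by
  have : π.tube V C = C ∩ ⋂ t, ({z | π.segMem t z V} ∩ {z | π.mem t z Cᶜ})ᶜ := by
    ext z
    simp only [tube, mem_ofPred_eq, mem_inter_iff, mem_iInter, mem_compl_iff, not_and]
    refine and_congr_right fun _ => forall_congr' fun t => imp_congr_right fun h => ?_
    obtain ⟨w, -, hw⟩ := h t le_rfl
    simp [mem, hw]
  rw [this]
  exact hC.inter (isClosed_iInter fun t =>
    ((isOpen_segMem t hV).inter (isOpen_mem t hC.isOpen_compl)).isClosed_compl)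

theorem tube_flow {V C : Set Z} {z w : Z} {t : ℝ≥0} (hz : z ∈ π.tube V C)
    (h : π.segMem t z V) (hw : π.flow t z = some w) : w ∈ π.tube V C := by
  refine ⟨?_, fun s hs => (mem_add_iff hw).1 (hz.2 _ (h.add hw hs))⟩
  obtain ⟨w', h', e⟩ := hz.2 t h
  rw [hw] at e
  exact Option.some.inj e ▸ h'

/-- An orbit starting in a tube either stays in the tube or meets the part of it outside `V`. -/
theorem exists_mem_tube_diff {V C : Set Z} (hV : IsOpen V) (hC : IsClosed C) {z : Z}
    (hz : z ∈ π.tube V C)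
    (hdef : ∀ t, (∀ s < t, π.mem s z V) → (π.flow t z).isSome) {t : ℝ≥0}
    (ht : ¬ π.mem t z (π.tube V C)) : ∃ s ≤ t, π.mem s z (π.tube V C \ V) := by
  have hex : ∃ s ≤ t, ¬ π.mem s z V := by
    by_contra! H
    obtain ⟨w, -, hw⟩ := H t le_rfl
    exact ht ⟨w, tube_flow hz H hw, hw⟩
  obtain ⟨s₁, hs₁, hn⟩ := hex
  have hcl : IsClosed {r : ℝ≥0 | ¬ π.mem r z V} := (isOpen_mem_time z hV).isClosed_compl
  have hmem := hcl.csInf_mem ⟨s₁, hn⟩ (OrderBot.bddBelow _)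
  set s := sInf {r : ℝ≥0 | ¬ π.mem r z V} with hs
  have hlt : ∀ r < s, π.mem r z V := fun r hr => by
    by_contra hr'
    exact absurd (csInf_le (OrderBot.bddBelow _) hr') (not_le.2 hr)
  obtain ⟨w, hw⟩ := Option.isSome_iff_exists.1 (hdef s hlt)
  have hwV : w ∉ V := fun h => hmem ⟨w, h, hw⟩
  refine ⟨s, (csInf_le (OrderBot.bddBelow _) hn).trans hs₁, w, ⟨⟨?_, fun r hr => ?_⟩, hwV⟩, hw⟩
  · rcases eq_zero_or_pos s with h0 | h0
    · rw [h0, π.flow_zero] at hw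
      exact Option.some.inj hw ▸ hz.1
    · exact mem_of_forall_lt hC h0
        (fun r hr => hz.2 r fun q hq => hlt q (hq.trans_lt hr)) hw
  · exact absurd (mem_zero_iff.1 (hr 0 zero_le)) hwV

end PartialSemiflow

theorem statement_0 (σ : GlobalSemiflow Y) (π : PartialSemiflow (Y × X)) (hσπ : σ.IsSkewProduct π) (y₀ : Y)
    (K : Set (Y × X)) (hKsub : K ⊆ extSpace σ y₀) (hKinv : K = π.Inv K)
    (N₁ N₂ M₁ M₂ : Set (ℝ≥0 × X))
    (hN : IsIndexPair σ π y₀ K N₁ N₂) (hM : IsIndexPair σ π y₀ K M₁ M₂)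
    (N : Set (Y × X)) (hNadm : π.StronglyAdmissible N) (hNnbhd : IsNbhdOfIn σ y₀ K N) :
    ∃ (t₀ : ℝ≥0) (L₁ L₂ : Set (ℝ≥0 × X)), IsIndexPair σ π y₀ K L₁ L₂ ∧
      L₁ ⊆ rMap σ y₀ ⁻¹' N ∩ N₁ ∩ M₁ ∧
      L₂ ⊆ backSet σ π y₀ N₁ N₂ t₀ ∩ backSet σ π y₀ M₁ M₂ t₀ := by
  obtain ⟨A, ⟨-, hAc, hAn, hAK⟩, hAadm, hA⟩ := hN.ip4
  obtain ⟨B, ⟨-, hBc, hBn, hBK⟩, hBadm, hB⟩ := hM.ip4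
  obtain ⟨A', ⟨-, hA'⟩, hA'sub⟩ := hN.ip5
  obtain ⟨B', ⟨-, hB'⟩, hB'sub⟩ := hM.ip5
  rw [← hAK] at hAn
  rw [← hBK] at hBn
  set E : Set (Y × X) := extSpace σ y₀ with hE
  have hEc : IsClosed E := isClosed_extSpace
  have hKc : IsCompact K := hAK ▸ hAadm.isCompact_Inv hAc
  have hKfwd : ∀ z ∈ K, ∀ t, π.mem t z K := fun z hz t => by
    rw [hKinv] at hz ⊢
    exact PartialSemiflow.mem_Inv_of_mem_Inv hz t
  obtain ⟨δ, hδ, hδsub⟩ : ∃ δ : ℝ, 0 < δ ∧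
      Metric.cthickening δ K ∩ E ⊆ N ∩ A ∩ B ∩ A' ∩ B' := by
    have hnhds : K ⊆ interior (N ∩ A ∩ B ∩ A' ∩ B' ∪ Eᶜ) := fun z hz => by
      have h := inter_mem (inter_mem (inter_mem (inter_mem (hNnbhd.2 z hz) (hAn z hz))
        (hBn z hz)) (hA' z hz)) (hB' z hz)
      rw [mem_interior_iff_mem_nhds]
      filter_upwards [mem_nhdsWithin_iff_eventually.1 h] with y hy
      exact or_iff_not_imp_right.2 fun hyE => hy (not_not.1 hyE)
    obtain ⟨δ, hδ, h⟩ := hKc.exists_cthickening_subset_open isOpen_interior hnhds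
    exact ⟨δ, hδ, fun z hz => (interior_subset (h hz.1)).resolve_right (not_not.2 hz.2)⟩
  set M : Set (Y × X) := Metric.cthickening δ K ∩ E with hMdef
  have hMA : M ⊆ A := fun z hz => (hδsub hz).1.1.1.2
  have hMB : M ⊆ B := fun z hz => (hδsub hz).1.1.2
  have hMc : IsClosed M := Metric.isClosed_cthickening.inter hEc
  have hMadm : π.StronglyAdmissible M := hAadm.mono hMA
  have hKM : K ⊆ M := fun z hz => ⟨Metric.self_subset_cthickening _ hz, hKsub hz⟩
  have hMK : K = π.Inv M := Subset.antisymm (hKinv.trans_subset (PartialSemiflow.Inv_mono hKM))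
    ((PartialSemiflow.Inv_mono hMA).trans hAK.superset)
  set I : Set (Y × X) := π.reachLimit M with hIdef
  have hIc : IsCompact I := hMadm.isCompact_reachLimit
  have hKI : K ⊆ I := hMK.trans_subset (PartialSemiflow.Inv_subset_reachLimit M)
  have hVW : Metric.cthickening (δ / 2) K ⊆ Metric.thickening δ K :=
    Metric.cthickening_subset_thickening' hδ (by linarith) K
  set V : Set (Y × X) := Metric.thickening (δ / 2) K with hV
  set W : Set (Y × X) := Metric.thickening δ K with hW
  have hVo : IsOpen V := Metric.isOpen_thickening
  have hWo : IsOpen W := Metric.isOpen_thickening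
  have hKV : K ⊆ V := Metric.self_subset_thickening (by linarith) K
  have hKW : K ⊆ W := Metric.self_subset_thickening hδ K
  have hWM : ∀ {z t}, z ∈ E → π.mem t z W → π.mem t z M := fun hz ⟨w, hw, e⟩ =>
    ⟨w, ⟨Metric.thickening_subset_cthickening _ _ hw, flow_mem_extSpace hσπ hz e⟩, e⟩
  have hVW' : V ⊆ W := (Metric.thickening_subset_cthickening _ _).trans hVW
  obtain ⟨ε₁, hε₁, T, hT⟩ := hMadm.exists_exit hMc hVo.isClosed_compl
    (by rw [← hMK]; exact disjoint_compl_left_iff_subset.2 hKV) hIc Subset.rfl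
  have hGo : IsOpen {z | π.segMem T z W} := PartialSemiflow.isOpen_segMem T hWo
  have hKG : K ⊆ {z | π.segMem T z W} := fun z hz s _ => (hKfwd z hz s).mono hKW
  obtain ⟨ε₂, hε₂, T₂, hT₂⟩ := hAadm.exists_exit hAc hGo.isClosed_compl
    (by rw [← hAK]; exact disjoint_compl_left_iff_subset.2 hKG) hIc
    (PartialSemiflow.reachLimit_mono hMA)
  obtain ⟨ε₃, hε₃, T₃, hT₃⟩ := hBadm.exists_exit hBc hGo.isClosed_compl
    (by rw [← hBK]; exact disjoint_compl_left_iff_subset.2 hKG) hIc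
    (PartialSemiflow.reachLimit_mono hMB)
  obtain ⟨ε, hε, h₁, h₂, h₃⟩ : ∃ ε : ℝ, 0 < ε ∧ ε ≤ ε₁ ∧ ε ≤ ε₂ ∧ ε ≤ ε₃ :=
    ⟨min ε₁ (min ε₂ ε₃), by positivity, by simp, by simp, by simp⟩
  set C : Set (Y × X) := Metric.cthickening (δ / 2) K ∩ E ∩ Metric.cthickening ε I with hC
  have hCc : IsClosed C := (Metric.isClosed_cthickening.inter hEc).inter
    Metric.isClosed_cthickening
  set P₁ : Set (Y × X) := π.tube V C with hP₁
  set P₂ : Set (Y × X) := P₁ ∩ {z | π.segMem T z W}ᶜ with hP₂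
  have hP₁M : P₁ ⊆ M := fun z hz =>
    ⟨Metric.thickening_subset_cthickening _ _ (hVW hz.1.1.1), hz.1.1.2⟩
  have hP₁c : IsClosed P₁ := PartialSemiflow.isClosed_tube hVo hCc
  have hbasic : IsBasicIndexPair σ π y₀ (rMap σ y₀ ⁻¹' P₁) (rMap σ y₀ ⁻¹' P₂) := by
    refine isBasicIndexPair_preimage hσπ inter_subset_left hP₁c
      (hP₁c.inter hGo.isClosed_compl) ?_ ?_
    · intro z hz hzE t ht
      obtain ⟨s, hs, w, ⟨hw, hwV⟩, e⟩ := PartialSemiflow.exists_mem_tube_diff hVo hCc hz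
        (fun t h => hMadm.2 z t fun s hs => hWM hzE ((h s hs).mono hVW')) ht
      refine ⟨s, hs, w, ⟨hw, fun hseg => ?_⟩, e⟩
      exact hT w hwV (Metric.cthickening_mono h₁ _ hw.1.2)
        fun r hr => hWM hw.1.1.2 (hseg r hr)
    · intro z hz t ht
      by_contra! H
      obtain ⟨w, hw, e⟩ := H t le_rfl
      have hwT : π.segMem T w W := by
        by_contra h
        exact ht ⟨w, ⟨hw, h⟩, e⟩
      refine hz.2 fun s hs => ?_
      exact PartialSemiflow.segMem.add (fun r hr => (H r hr).mono fun y hy => hVW hy.1.1.1) e hwT s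
        (hs.trans le_add_self)
  have hsub : rMap σ y₀ ⁻¹' P₁ ⊆ rMap σ y₀ ⁻¹' N ∩ N₁ ∩ M₁ := fun p hp =>
    have h := hδsub (hP₁M hp)
    ⟨⟨h.1.1.1.1, (hA'sub h.1.2).1⟩, (hB'sub h.2).1⟩
  refine ⟨max T₂ T₃, _, _, ⟨hbasic, ⟨M, ⟨inter_subset_right, hMc, ?_, hMK⟩, hMadm, ?_⟩, ?_⟩,
    hsub, fun p hp => ⟨?_, ?_⟩⟩
  · rw [← hMK]
    exact fun z hz => inter_mem (mem_nhdsWithin_of_mem_nhds (mem_of_superset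
      (hWo.mem_nhds (hKW hz)) (Metric.thickening_subset_cthickening _ _))) self_mem_nhdsWithin
  · exact fun p hp => hP₁M hp.1
  · obtain ⟨S, hS⟩ := hMadm.exists_stay hε
    have hOo : IsOpen {z | π.segMem S z (Metric.thickening ε I)} :=
      PartialSemiflow.isOpen_segMem S Metric.isOpen_thickening
    refine ⟨E ∩ (V ∩ {z | π.segMem T z W} ∩ {z | π.segMem S z (Metric.thickening ε I)}),
      ⟨inter_subset_left, fun z hz => ?_⟩, ?_⟩
    · refine inter_mem self_mem_nhdsWithin (mem_nhdsWithin_of_mem_nhds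
        (((hVo.inter hGo).inter hOo).mem_nhds ⟨⟨hKV hz, hKG hz⟩, fun s _ => ?_⟩))
      exact (hKfwd z hz s).mono (hKI.trans (Metric.self_subset_thickening hε I))
    · rintro p ⟨hpE, ⟨hpV, hpT⟩, hpS⟩
      refine ⟨⟨⟨⟨Metric.thickening_subset_cthickening _ _ hpV, hpE⟩, ?_⟩, fun t ht => ?_⟩,
        fun h => h.2 hpT⟩
      · exact Metric.thickening_subset_cthickening _ _
          (PartialSemiflow.mem_zero_iff.1 (hpS 0 zero_le))
      · obtain ⟨w, hw, e⟩ := hS _ hpS t fun s hs => hWM hpE ((ht s hs).mono hVW')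
        obtain ⟨w', hw', e'⟩ := ht t le_rfl
        obtain rfl : w' = w := Option.some.inj (e'.symm.trans e)
        exact ⟨w', ⟨⟨Metric.thickening_subset_cthickening _ _ hw',
          flow_mem_extSpace hσπ hpE e⟩, hw⟩, e⟩
  · refine hN.toBasic.mem_backSet hσπ hA (hsub hp.1).1.2 fun h => ?_
    exact hT₂ _ hp.2 (Metric.cthickening_mono h₂ _ hp.1.1.2)
      fun s hs => h s (hs.trans (le_max_left _ _))
  · refine hM.toBasic.mem_backSet hσπ hB (hsub hp.1).2 fun h => ?_
    exact hT₃ _ hp.2 (Metric.cthickening_mono h₃ _ hp.1.1.2)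
      fun s hs => h s (hs.trans (le_max_right _ _))

end
end

section
/- Let K ⊂ H⁺(y₀)×X be an invariant set and let (N₁,N₂) be an index pair for (y₀,K). Then for every T ≥ 0, the pair (N₁, N₂^{−T}(N₁)) is also an index pair for (y₀,K). -/
open Filter Topology Set
open scoped NNReal ENNReal

noncomputable section

variable {X Y : Type*} [MetricSpace X] [MetricSpace Y]

variable {X Y : Type*} [MetricSpace X] [MetricSpace Y]

lemma chi_zero (σ : GlobalSemiflow Y) (π : PartialSemiflow (Y × X)) (y₀ : Y) (p : ℝ≥0 × X) :
    chi σ π y₀ 0 p = some p := by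
  simp [chi, π.flow_zero]

lemma chi_add {σ : GlobalSemiflow Y} {π : PartialSemiflow (Y × X)} (hσπ : σ.IsSkewProduct π)
    (y₀ : Y) {s : ℝ≥0} {p q : ℝ≥0 × X} (hq : chi σ π y₀ s p = some q) (t : ℝ≥0) :
    chi σ π y₀ (s + t) p = chi σ π y₀ t q := by
  obtain ⟨w, hw, rfl⟩ := Option.map_eq_some_iff.1 hq
  have h₁ : σ.trans (p.1 + s) y₀ = w.1 := by rw [σ.trans_add, hσπ _ _ _ _ hw]
  simp [chi, π.flow_add, hw, h₁, add_assoc]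

lemma chiMem_add_iff {σ : GlobalSemiflow Y} {π : PartialSemiflow (Y × X)}
    (hσπ : σ.IsSkewProduct π) (y₀ : Y) {s : ℝ≥0} {p q : ℝ≥0 × X}
    (hq : chi σ π y₀ s p = some q) (t : ℝ≥0) (M : Set (ℝ≥0 × X)) :
    chiMem σ π y₀ (s + t) p M ↔ chiMem σ π y₀ t q M := by
  simp only [chiMem, chi_add hσπ y₀ hq t]

/-- The semiflow `χ` is jointly continuous on its open domain. -/
lemma isOpen_setOf_chiMem (σ : GlobalSemiflow Y) (π : PartialSemiflow (Y × X)) (y₀ : Y)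
    {V : Set (ℝ≥0 × X)} (hV : IsOpen V) :
    IsOpen {z : (ℝ≥0 × X) × ℝ≥0 | chiMem σ π y₀ z.2 z.1 V} := by
  rw [isOpen_iff_mem_nhds]
  rintro ⟨p, s⟩ ⟨q, hqV, hq⟩
  obtain ⟨w, hw, rfl⟩ := Option.map_eq_some_iff.1 hq
  obtain ⟨A, B, hA, hB, hpA, hwB, hAB⟩ := isOpen_prod_iff.1 hV _ _ hqV
  have hτ : Continuous fun t : ℝ≥0 => σ.trans t y₀ :=
    σ.continuous_trans.comp (continuous_id.prodMk continuous_const)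
  have hc : Continuous fun z : (ℝ≥0 × X) × ℝ≥0 => (z.2, (σ.trans z.1.1 y₀, z.1.2)) :=
    continuous_snd.prodMk ((hτ.comp (continuous_fst.comp continuous_fst)).prodMk
      (continuous_snd.comp continuous_fst))
  have h₁ := ((π.continuous_flow _ (hB.preimage continuous_snd)).preimage hc).mem_nhds
    (x := (p, s)) ⟨w, hwB, hw⟩
  have h₂ := (hA.preimage (f := fun z : (ℝ≥0 × X) × ℝ≥0 => z.1.1 + z.2)
    (by fun_prop)).mem_nhds (x := (p, s)) hpA
  filter_upwards [h₁, h₂] with z hz₁ hz₂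
  obtain ⟨v, hvB, hv⟩ := hz₁
  exact ⟨(z.1.1 + z.2, v.2), hAB ⟨hz₂, hvB⟩, Option.map_eq_some_iff.2 ⟨v, hv, rfl⟩⟩

lemma mem_nhds_of_forall_chiMem (σ : GlobalSemiflow Y) (π : PartialSemiflow (Y × X)) (y₀ : Y)
    {V : Set (ℝ≥0 × X)} (hV : IsOpen V) {p : ℝ≥0 × X} {T : ℝ≥0}
    (hp : ∀ s ≤ T, chiMem σ π y₀ s p V) :
    ∀ᶠ q in 𝓝 p, ∀ s ≤ T, chiMem σ π y₀ s q V := by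
  have h := (isCompact_Icc (a := (0 : ℝ≥0)) (b := T)).eventually_forall_of_forall_eventually
    (x₀ := p) (P := fun q s => chiMem σ π y₀ s q V)
    fun s hs => (isOpen_setOf_chiMem σ π y₀ hV).mem_nhds (hp s hs.2)
  exact h.mono fun q hq s hs => hq s ⟨zero_le, hs⟩

lemma IsBasicIndexPair.isClosed_backSet {σ : GlobalSemiflow Y} {π : PartialSemiflow (Y × X)}
    {y₀ : Y} {N₁ N₂ : Set (ℝ≥0 × X)} (h : IsBasicIndexPair σ π y₀ N₁ N₂) (T : ℝ≥0) :
    IsClosed (backSet σ π y₀ N₁ N₂ T) := by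
  rw [← isOpen_compl_iff, isOpen_iff_mem_nhds]
  intro p hp
  by_cases hp₁ : p ∈ N₁
  · have hN₂ : ∀ s ≤ T, ¬ chiMem σ π y₀ s p N₂ := fun s hs hs₂ => hp ⟨hp₁, s, hs, hs₂⟩
    have hc : ∀ s ≤ T, chiMem σ π y₀ s p N₂ᶜ := by
      intro s hs
      by_cases hs₁ : chiMem σ π y₀ s p N₁
      · obtain ⟨q, -, hq⟩ := hs₁
        exact ⟨q, fun hq₂ => hN₂ s hs ⟨q, hq₂, hq⟩, hq⟩
      · obtain ⟨s', hs', hs₂⟩ := h.ip2 p hp₁ s hs₁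
        exact absurd hs₂ (hN₂ s' (hs'.trans hs))
    filter_upwards [mem_nhds_of_forall_chiMem σ π y₀ h.closed₂.isOpen_compl hc] with q hq hqT
    obtain ⟨-, s, hs, w, hw, hqw⟩ := hqT
    obtain ⟨v, hv, hqv⟩ := hq s hs
    exact hv (Option.some.inj (hqw.symm.trans hqv) ▸ hw)
  · filter_upwards [h.closed₁.isOpen_compl.mem_nhds hp₁] with q hq hqT
    exact hq hqT.1

lemma subset_backSet (σ : GlobalSemiflow Y) (π : PartialSemiflow (Y × X)) (y₀ : Y)
    {N₁ N₂ : Set (ℝ≥0 × X)} (h : N₂ ⊆ N₁) (T : ℝ≥0) : N₂ ⊆ backSet σ π y₀ N₁ N₂ T :=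
  fun p hp => ⟨h hp, 0, zero_le, p, hp, chi_zero σ π y₀ p⟩

lemma IsBasicIndexPair.backSet {σ : GlobalSemiflow Y} {π : PartialSemiflow (Y × X)}
    (hσπ : σ.IsSkewProduct π) {y₀ : Y} {N₁ N₂ : Set (ℝ≥0 × X)}
    (h : IsBasicIndexPair σ π y₀ N₁ N₂) (T : ℝ≥0) :
    IsBasicIndexPair σ π y₀ N₁ (backSet σ π y₀ N₁ N₂ T) where
  subset := fun _ hp => hp.1
  closed₁ := h.closed₁
  closed₂ := h.isClosed_backSet T
  ip2 p hp t ht := by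
    obtain ⟨s, hs, q, hq, hpq⟩ := h.ip2 p hp t ht
    exact ⟨s, hs, q, subset_backSet σ π y₀ h.subset T hq, hpq⟩
  ip3 := by
    rintro p ⟨-, s, hsT, q, hq₂, hq⟩ t ht
    by_contra! hN₁
    obtain ⟨w, hw₁, hw⟩ := hN₁ t le_rfl
    refine ht ⟨w, ?_, hw⟩
    rcases le_total t s with hts | hst
    · refine ⟨hw₁, s - t, tsub_le_self.trans hsT, ?_⟩
      rw [← chiMem_add_iff hσπ y₀ hw, add_tsub_cancel_of_le hts]
      exact ⟨q, hq₂, hq⟩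
    · apply subset_backSet σ π y₀ h.subset T
      have hqw : chi σ π y₀ (t - s) q = some w := by
        rw [← chi_add hσπ y₀ hq, add_tsub_cancel_of_le hst, hw]
      by_contra hw₂
      obtain ⟨s', hs', hs₁⟩ := h.ip3 q hq₂ (t - s) (by
        rintro ⟨v, hv, hqv⟩
        exact hw₂ (Option.some.inj (hqw.symm.trans hqv) ▸ hv))
      refine hs₁ ((chiMem_add_iff hσπ y₀ hq s' N₁).1 (hN₁ _ ?_))
      calc s + s' ≤ s + (t - s) := by gcongr
        _ = t := add_tsub_cancel_of_le hst

lemma trans_mem_hullPlus (σ : GlobalSemiflow Y) {y₀ y : Y} (hy : y ∈ hullPlus σ y₀) (t : ℝ≥0) :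
    σ.trans t y ∈ hullPlus σ y₀ := by
  have hc : Continuous fun y => σ.trans t y :=
    σ.continuous_trans.comp (continuous_const.prodMk continuous_id)
  refine map_mem_closure hc hy ?_
  rintro _ ⟨s, rfl⟩
  exact ⟨s + t, σ.trans_add s t y₀⟩

/-- Points whose orbit segment over `[0,T]` stays in a neighborhood of an invariant set form
a neighborhood of that invariant set. -/
lemma isNbhdOfIn_setOf_segMem {σ : GlobalSemiflow Y} {π : PartialSemiflow (Y × X)}
    (hσπ : σ.IsSkewProduct π) {y₀ : Y} {K W : Set (Y × X)}
    (hKinv : K = π.Inv K) (hW : IsNbhdOfIn σ y₀ K W) (T : ℝ≥0) :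
    IsNbhdOfIn σ y₀ K {z ∈ extSpace σ y₀ | π.segMem T z W} := by
  refine ⟨fun z hz => hz.1, fun z hz => ?_⟩
  obtain ⟨u, hu, huK, rfl⟩ := hKinv.subset hz
  have hev : ∀ᶠ z in 𝓝 (u 0), ∀ s ∈ Icc (0 : ℝ≥0) T, z ∈ extSpace σ y₀ → π.mem s z W := by
    refine isCompact_Icc.eventually_forall_of_forall_eventually fun s _ => ?_
    obtain ⟨O, hO, huO, hOW⟩ := mem_nhdsWithin.1 (hW.2 _ (huK (0 + s)))
    have h := ((π.continuous_flow O hO).preimage continuous_swap).mem_nhds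
      (x := (u 0, s)) ⟨_, huO, hu 0 s⟩
    filter_upwards [h]
    rintro ⟨z, t⟩ ⟨w, hwO, hw⟩ hzE
    refine ⟨w, hOW ⟨hwO, ?_, mem_univ _⟩, hw⟩
    rw [hσπ t z.1 z.2 w hw]
    exact trans_mem_hullPlus σ hzE.1 t
  filter_upwards [mem_nhdsWithin_of_mem_nhds hev, self_mem_nhdsWithin] with z hz hzE
  exact ⟨hzE, fun s hs => hz s ⟨zero_le, hs⟩ hzE⟩

theorem statement_3 (σ : GlobalSemiflow Y) (π : PartialSemiflow (Y × X)) (hσπ : σ.IsSkewProduct π) (y₀ : Y)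
    (K : Set (Y × X)) (hKsub : K ⊆ extSpace σ y₀) (hKinv : K = π.Inv K)
    (N₁ N₂ : Set (ℝ≥0 × X)) (hN : IsIndexPair σ π y₀ K N₁ N₂) :
    ∀ T : ℝ≥0, IsIndexPair σ π y₀ K N₁ (backSet σ π y₀ N₁ N₂ T) := by
  intro T
  refine ⟨hN.toBasic.backSet hσπ T, ?_, ?_⟩
  · obtain ⟨N, hNK, hNadm, hsub⟩ := hN.ip4
    exact ⟨N, hNK, hNadm, (sdiff_subset_sdiff_right
      (subset_backSet σ π y₀ hN.toBasic.subset T)).trans hsub⟩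
  · obtain ⟨W, hW, hWsub⟩ := hN.ip5
    refine ⟨_, isNbhdOfIn_setOf_segMem hσπ hKinv hW T, ?_⟩
    have hmem : ∀ p : ℝ≥0 × X, π.segMem T (rMap σ y₀ p) W →
        ∀ s ≤ T, chiMem σ π y₀ s p (N₁ \ N₂) := by
      intro p hp s hs
      obtain ⟨w, hwW, hw⟩ := hp s hs
      refine ⟨(p.1 + s, w.2), hWsub ?_, Option.map_eq_some_iff.2 ⟨w, hw, rfl⟩⟩
      have hr : rMap σ y₀ (p.1 + s, w.2) = w :=
        Prod.ext (by rw [hσπ _ _ _ _ hw]; exact σ.trans_add _ _ _) rfl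
      rwa [mem_preimage, hr]
    rintro p ⟨-, hp⟩
    refine ⟨?_, ?_⟩
    · obtain ⟨q, hq, hpq⟩ := hmem p hp 0 zero_le
      rw [chi_zero] at hpq
      exact Option.some.inj hpq ▸ hq.1
    · rintro ⟨-, s, hs, v, hv, hpv⟩
      obtain ⟨q, hq, hpq⟩ := hmem p hp s hs
      exact hq.2 (Option.some.inj (hpv.symm.trans hpq) ▸ hv)

end
end
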